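/- The Nash optimum guarantees utilitarian social welfare at least n/2: for every profile x ∈ [0,1]^n and every Nash optimum y* for x, USW(y*, x) ≥ n/2. -/

import Mathlib

open Set

noncomputable section

/-- Utility of an agent at location `z` when the facility is at `y`. -/
def util (y z : ℝ) : ℝ := 1 - |y - z|

/-- Nash welfare: product of agents' utilities. -/
def nash {n : ℕ} (y : ℝ) (x : Fin n → ℝ) : ℝ := ∏ i, util y (x i)

/-- `y` is a Nash optimum for the profile `x`. -/
def isNashOpt {n : ℕ} (x : Fin n → ℝ) (y : ℝ) : Prop :=
  y ∈ Set.Icc (0 : ℝ) 1 ∧ ∀ z ∈ Set.Icc (0 : ℝ) 1, nash z x ≤ nash y x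

/-- Utilitarian social welfare: sum of agents' utilities. -/
def usw {n : ℕ} (y : ℝ) (x : Fin n → ℝ) : ℝ := ∑ i, util y (x i)

theorem util_nonneg {y z : ℝ} (hy : y ∈ Set.Icc (0 : ℝ) 1) (hz : z ∈ Set.Icc (0 : ℝ) 1) :
    0 ≤ util y z := by
  have h : |y - z| ≤ 1 := abs_le.2 ⟨by linarith [hy.1, hz.2], by linarith [hy.2, hz.1]⟩
  unfold util
  linarith

theorem half_le_util_half {z : ℝ} (hz : z ∈ Set.Icc (0 : ℝ) 1) : 1 / 2 ≤ util (1 / 2) z := by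
  have h : |1 / 2 - z| ≤ 1 / 2 := abs_le.2 ⟨by linarith [hz.2], by linarith [hz.1]⟩
  unfold util
  linarith

/-- Nonnegative reals with product at least `2⁻ⁿ` have sum at least `n / 2`. -/
theorem half_card_le_sum_of_half_pow_le_prod {n : ℕ} {u : Fin n → ℝ} (hu : ∀ i, 0 ≤ u i)
    (h : (1 / 2 : ℝ) ^ n ≤ ∏ i, u i) : (n : ℝ) / 2 ≤ ∑ i, u i := by
  have h_prod : 1 ≤ ∏ i, 2 * u i := by
    calc (1 : ℝ) = 2 ^ n * (1 / 2) ^ n := by rw [← mul_pow]; norm_num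
      _ ≤ 2 ^ n * ∏ i, u i := by gcongr
      _ = ∏ i, 2 * u i := by simp [Finset.prod_mul_distrib]
  have h_exp : ∏ i, 2 * u i ≤ Real.exp (∑ i, (2 * u i - 1)) := by
    rw [Real.exp_sum]
    refine Finset.prod_le_prod (fun i _ => by linarith [hu i]) fun i _ => ?_
    linarith [Real.add_one_le_exp (2 * u i - 1)]
  have h_sum : 0 ≤ ∑ i, (2 * u i - 1) := Real.one_le_exp_iff.1 (h_prod.trans h_exp)
  rw [Finset.sum_sub_distrib, ← Finset.mul_sum] at h_sum
  simp only [Finset.sum_const, Finset.card_univ, Fintype.card_fin, nsmul_eq_mul, mul_one]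
    at h_sum
  linarith

theorem nashFL_usw_guarantee (n : ℕ) (x : Fin n → ℝ)
    (hx : ∀ i, x i ∈ Set.Icc (0 : ℝ) 1)
    (ystar : ℝ) (hy : isNashOpt x ystar) :
    usw ystar x ≥ (n : ℝ) / 2 := by
  refine half_card_le_sum_of_half_pow_le_prod (fun i => util_nonneg hy.1 (hx i)) ?_
  refine le_trans ?_ (hy.2 (1 / 2) ⟨by norm_num, by norm_num⟩)
  calc (1 / 2 : ℝ) ^ n = ∏ _i : Fin n, (1 / 2 : ℝ) := by simp
    _ ≤ nash (1 / 2) x :=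
      Finset.prod_le_prod (fun _ _ => by norm_num) fun i _ => half_le_util_half (hx i)
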